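/- arXiv:2306.10918 — 4 statements merged into one kernel-verified Lean document; each statement's English description precedes it below -/
import Mathlib

section
/- Let R be a commutative ring, n a natural number, a, b, c ∈ R, x, y ∈ R^n, and A an n×n matrix over R. Define the (n+2)×(n+2) matrix M with first row (a, b, xᵀ), second row (b, c, yᵀ), and remaining rows (x, y, A) (i.e., M has top-left 2×2 block [[a,b],[b,c]], top-right block with rows xᵀ and yᵀ, bottom-left block with columns x and y, and bottom-right block A); define M' identically except with top-left 2×2 block [[a−1, b+1],[b+1, c−1]]; and define the (n+1)×(n+1) matrix M'' with first row (a + c + 2b, (x+y)ᵀ), bottom-left column x + y, and bottom-right block A. Then det M = det M' + det M''. -/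
open Matrix

/-- A unimodular change of basis in the first block of a bordered block matrix
preserves its determinant. -/
theorem det_fromBlocks_conj_of_det_eq_one {R l m : Type*} [CommRing R] [Fintype l] [DecidableEq l]
    [Fintype m] [DecidableEq m] (Q P : Matrix l l R) (X : Matrix l m R) (A : Matrix m m R)
    (hQ : Q.det = 1) :
    (fromBlocks (Q * P * Qᵀ) (Q * X) (Q * X)ᵀ A).det = (fromBlocks P X Xᵀ A).det := by
  have h : fromBlocks (Q * P * Qᵀ) (Q * X) (Q * X)ᵀ A =
      fromBlocks Q 0 0 1 * fromBlocks P X Xᵀ A * fromBlocks Qᵀ 0 0 1 := by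
    simp [fromBlocks_multiply, transpose_mul]
  rw [h, det_mul, det_mul, det_fromBlocks_zero₂₁, det_fromBlocks_zero₂₁]
  simp [hQ]

/-- The determinant is affine in the top left entry, with slope the complementary minor. -/
theorem det_fromBlocks_add_one_apply_zero_zero {R m : Type*} [CommRing R] [Fintype m]
    [DecidableEq m] (p q r s : R) (u v : m → R) (Y : Matrix m (Fin 2) R) (A : Matrix m m R) :
    (fromBlocks !![p + 1, q; r, s] (of ![u, v]) Y A).det =
      (fromBlocks !![p, q; r, s] (of ![u, v]) Y A).det +
        (fromBlocks !![s] (of ![v]) (Y.submatrix id ![1]) A).det := by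
  set N := fromBlocks !![p, q; r, s] (of ![u, v]) Y A with hN
  have hadd : fromBlocks !![p + 1, q; r, s] (of ![u, v]) Y A =
      N.updateRow (Sum.inl 0) (N (Sum.inl 0) + Pi.single (Sum.inl 0) 1) := by
    ext i j
    rcases i with i | i <;> rcases j with j | j
    · fin_cases i <;> fin_cases j <;> simp [hN, updateRow_apply]
    · fin_cases i <;> simp [hN, updateRow_apply]
    · simp [hN, updateRow_apply]
    · simp [hN, updateRow_apply]
  let e : Fin 1 ⊕ (Fin 1 ⊕ m) ≃ Fin 2 ⊕ m :=
    (Equiv.sumAssoc _ _ _).symm.trans (Equiv.sumCongr finSumFinEquiv (Equiv.refl m))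
  have hminor : (N.updateRow (Sum.inl 0) (Pi.single (Sum.inl 0) 1)).submatrix e e =
      fromBlocks 1 0 (of (Sum.elim (fun _ _ => r) (fun i _ => Y i 0)))
        (fromBlocks !![s] (of ![v]) (Y.submatrix id ![1]) A) := by
    ext i j
    rcases i with i | i | i <;> rcases j with j | j | j <;>
      simp [e, hN, updateRow_apply, finSumFinEquiv, Subsingleton.elim _ (0 : Fin 1)]
  rw [hadd, det_updateRow_add, updateRow_eq_self, ← det_submatrix_equiv_self e
    (N.updateRow (Sum.inl 0) (Pi.single (Sum.inl 0) 1)), hminor, det_fromBlocks_zero₁₂, det_one,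
    one_mul]

/-- Deletion–contraction determinant identity for linking matrices of chainmail
graphs, in block-matrix form over an arbitrary commutative ring. -/
theorem det_deletion_contraction
    (R : Type*) [CommRing R] (n : ℕ) (a b c : R) (x y : Fin n → R)
    (A : Matrix (Fin n) (Fin n) R) :
    let M : Matrix (Fin 2 ⊕ Fin n) (Fin 2 ⊕ Fin n) R :=
      Matrix.fromBlocks !![a, b; b, c] (Matrix.of ![x, y]) (Matrix.of ![x, y])ᵀ A
    let M' : Matrix (Fin 2 ⊕ Fin n) (Fin 2 ⊕ Fin n) R :=
      Matrix.fromBlocks !![a - 1, b + 1; b + 1, c - 1]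
        (Matrix.of ![x, y]) (Matrix.of ![x, y])ᵀ A
    let M'' : Matrix (Fin 1 ⊕ Fin n) (Fin 1 ⊕ Fin n) R :=
      Matrix.fromBlocks !![a + c + 2 * b] (Matrix.of ![x + y]) (Matrix.of ![x + y])ᵀ A
    M.det = M'.det + M''.det := by
  intro M M' M''
  have hQ : (!![1, 0; 1, 1] : Matrix (Fin 2) (Fin 2) R).det = 1 := by simp [det_fin_two]
  have hX : (!![1, 0; 1, 1] : Matrix (Fin 2) (Fin 2) R) * of ![x, y] = of ![x, x + y] := by
    ext i j
    fin_cases i <;> simp [mul_apply, Fin.sum_univ_two]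
  have hP : !![1, 0; 1, 1] * !![a, b; b, c] * (!![1, 0; 1, 1])ᵀ =
      !![a - 1 + 1, a + b; a + b, a + c + 2 * b] := by
    ext i j
    fin_cases i <;> fin_cases j <;> simp [mul_apply, Fin.sum_univ_two] <;> ring
  have hP' : !![1, 0; 1, 1] * !![a - 1, b + 1; b + 1, c - 1] * (!![1, 0; 1, 1])ᵀ =
      !![a - 1, a + b; a + b, a + c + 2 * b] := by
    ext i j
    fin_cases i <;> fin_cases j <;> simp [mul_apply, Fin.sum_univ_two] <;> ring
  have hY : (of ![x, x + y])ᵀ.submatrix id ![1] = (of ![x + y])ᵀ := by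
    ext i j
    fin_cases j
    simp
  simp only [M, M', M'']
  rw [← det_fromBlocks_conj_of_det_eq_one _ !![a, b; b, c] _ _ hQ,
    ← det_fromBlocks_conj_of_det_eq_one _ !![a - 1, b + 1; b + 1, c - 1] _ _ hQ, hX, hP, hP',
    det_fromBlocks_add_one_apply_zero_zero, hY]
end

section
/- Let V be a finite type and W : Matrix V V ℝ a symmetric matrix with nonnegative entries, with weighted Laplacian L defined by L i j = (if i = j then ∑ₖ W i k else 0) − W i j, and let H be the support graph of W (i adjacent to j iff i ≠ j and W i j ≠ 0). Let ν : V → ℝ satisfy ν v ≥ 0 for all v, and suppose that every vertex v ∈ V can reach in H some vertex w with ν w > 0. Then the matrix Matrix.diagonal ν + L is positive definite; in particular its determinant is strictly positive. -/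
open Matrix

theorem dotProduct_mulVec_diagonal_add_weighted_laplacian
    {V : Type*} [Fintype V] [DecidableEq V] {W : Matrix V V ℝ} (hSymm : W.IsSymm)
    {L : Matrix V V ℝ} (hL : ∀ i j, L i j = (if i = j then ∑ k, W i k else 0) - W i j)
    (ν x : V → ℝ) :
    x ⬝ᵥ ((Matrix.diagonal ν + L) *ᵥ x) =
      ∑ i, ν i * x i ^ 2 + (∑ i, ∑ j, W i j * (x i - x j) ^ 2) / 2 := by
  have hLx (i : V) : (L *ᵥ x) i = (∑ k, W i k) * x i - ∑ j, W i j * x j := by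
    simp [Matrix.mulVec, dotProduct, hL, sub_mul, Finset.sum_sub_distrib]
  have hswap : ∑ i, ∑ j, W i j * x j ^ 2 = ∑ i, ∑ j, W i j * x i ^ 2 := by
    rw [Finset.sum_comm]
    simp only [hSymm.apply]
  have hexpand : ∑ i, ∑ j, W i j * (x i - x j) ^ 2 =
      ∑ i, ∑ j, W i j * x i ^ 2 + ∑ i, ∑ j, W i j * x j ^ 2
        - 2 * ∑ i, ∑ j, W i j * x i * x j := by
    simp only [Finset.mul_sum, ← Finset.sum_add_distrib, ← Finset.sum_sub_distrib]
    refine Finset.sum_congr rfl fun i _ => Finset.sum_congr rfl fun j _ => ?_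
    ring
  have hquad : ∑ i, x i * (L *ᵥ x) i =
      ∑ i, ∑ j, W i j * x i ^ 2 - ∑ i, ∑ j, W i j * x i * x j := by
    simp only [hLx, mul_sub, Finset.mul_sum, Finset.sum_mul, ← Finset.sum_sub_distrib]
    refine Finset.sum_congr rfl fun i _ => Finset.sum_congr rfl fun j _ => ?_
    ring
  have hdiag : ∑ i, x i * (ν i * x i) = ∑ i, ν i * x i ^ 2 :=
    Finset.sum_congr rfl fun i _ => by ring
  simp only [Matrix.add_mulVec, dotProduct_add]
  simp only [dotProduct, Matrix.mulVec_diagonal]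
  rw [hexpand, hswap, hdiag, hquad]
  ring

/-- If `ν ≥ 0` and every vertex can reach (in the support graph of `W`) a
vertex of positive weight, then `diagonal ν + L` is positive definite; in
particular its determinant is strictly positive. -/
theorem diagonal_add_weighted_laplacian_posDef
    (V : Type*) [Fintype V] [DecidableEq V]
    (W : Matrix V V ℝ) (hSymm : W.IsSymm) (hNonneg : ∀ i j, 0 ≤ W i j)
    (L : Matrix V V ℝ)
    (hL : ∀ i j, L i j = (if i = j then ∑ k, W i k else 0) - W i j)
    (H : SimpleGraph V)
    (hH : ∀ i j, H.Adj i j ↔ i ≠ j ∧ W i j ≠ 0)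
    (ν : V → ℝ) (hν : ∀ v, 0 ≤ ν v)
    (hreach : ∀ v : V, ∃ w : V, H.Reachable v w ∧ 0 < ν w) :
    (Matrix.diagonal ν + L).PosDef ∧ 0 < (Matrix.diagonal ν + L).det := by
  have hpos : (Matrix.diagonal ν + L).PosDef := by
    refine .of_dotProduct_mulVec_pos ?_ fun x hx => ?_
    · ext i j
      by_cases hij : i = j
      · simp [hij]
      · simp [hL, hij, Ne.symm hij, hSymm.apply]
    · rw [star_trivial, dotProduct_mulVec_diagonal_add_weighted_laplacian hSymm hL]
      have hdiag (i : V) : 0 ≤ ν i * x i ^ 2 := mul_nonneg (hν i) (sq_nonneg _)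
      have hedge (i j : V) : 0 ≤ W i j * (x i - x j) ^ 2 :=
        mul_nonneg (hNonneg i j) (sq_nonneg _)
      have hrow (i : V) : 0 ≤ ∑ j, W i j * (x i - x j) ^ 2 :=
        Finset.sum_nonneg fun j _ => hedge i j
      have hdiag_sum := Finset.sum_nonneg fun i (_ : i ∈ Finset.univ) => hdiag i
      have hedge_sum := Finset.sum_nonneg fun i (_ : i ∈ Finset.univ) => hrow i
      by_contra hle
      have hdiag_zero (i : V) : ν i * x i ^ 2 = 0 :=
        (Finset.sum_eq_zero_iff_of_nonneg fun i _ => hdiag i).1 (by linarith) i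
          (Finset.mem_univ i)
      have hrow_zero (i : V) : ∑ j, W i j * (x i - x j) ^ 2 = 0 :=
        (Finset.sum_eq_zero_iff_of_nonneg fun i _ => hrow i).1 (by linarith) i
          (Finset.mem_univ i)
      have hedge_zero (i j : V) : W i j * (x i - x j) ^ 2 = 0 :=
        (Finset.sum_eq_zero_iff_of_nonneg fun j _ => hedge i j).1 (hrow_zero i) j
          (Finset.mem_univ j)
      have hadj {i j : V} (h : H.Adj i j) : x i = x j := by
        simpa [((hH i j).1 h).2, sub_eq_zero] using hedge_zero i j
      have hwalk {i j : V} (p : H.Walk i j) : x i = x j := by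
        induction p with
        | nil => rfl
        | cons h _ ih => exact (hadj h).trans ih
      refine hx (funext fun v => ?_)
      obtain ⟨w, ⟨p⟩, hw⟩ := hreach v
      rw [hwalk p]
      simpa [hw.ne'] using hdiag_zero w
  exact ⟨hpos, hpos.det_pos⟩
end

section
/- Let V be a finite type, G a simple graph on V with decidable adjacency, and ν : V → ℝ with ν v ≥ 0 for all v ∈ V. Suppose that for every vertex v ∈ V there exists a vertex w reachable from v in G with ν w > 0 (i.e., each connected component of G contains a vertex of positive weight). Then the matrix Matrix.diagonal ν + G.lapMatrix ℝ is positive definite, and in particular det (Matrix.diagonal ν + G.lapMatrix ℝ) > 0. -/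
open Matrix

/-- For a simple graph `G` and nonnegative vertex weights `ν` such that every
connected component of `G` contains a vertex of positive weight, the matrix
`diagonal ν + lapMatrix ℝ G` (the linking matrix of the associated negative
alternating chainmail link) is positive definite; in particular its
determinant is strictly positive. -/
theorem diagonal_add_lapMatrix_posDef
    (V : Type*) [Fintype V] [DecidableEq V]
    (G : SimpleGraph V) [DecidableRel G.Adj]
    (ν : V → ℝ) (hν : ∀ v, 0 ≤ ν v)
    (hreach : ∀ v : V, ∃ w : V, G.Reachable v w ∧ 0 < ν w) :
    (Matrix.diagonal ν + G.lapMatrix ℝ).PosDef ∧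
    0 < (Matrix.diagonal ν + G.lapMatrix ℝ).det := by
  have hL := SimpleGraph.posSemidef_lapMatrix ℝ G
  have hpos : (Matrix.diagonal ν + G.lapMatrix ℝ).PosDef := by
    refine .of_dotProduct_mulVec_pos ((PosSemidef.diagonal hν).isHermitian.add hL.isHermitian)
      fun x hx ↦ ?_
    obtain ⟨v, hv⟩ := Function.ne_iff.mp hx
    obtain ⟨w, hvw, hw⟩ := hreach v
    have hdiag : star x ⬝ᵥ (Matrix.diagonal ν *ᵥ x) = ∑ i, ν i * x i ^ 2 := by
      simp only [dotProduct, mulVec_diagonal, star_trivial]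
      exact Finset.sum_congr rfl fun i _ ↦ by ring
    have hterm (i : V) : 0 ≤ ν i * x i ^ 2 := mul_nonneg (hν i) (sq_nonneg _)
    rw [add_mulVec, dotProduct_add, hdiag]
    rcases (hL.dotProduct_mulVec_nonneg x).eq_or_lt with h | h
    · rw [star_trivial, ← toLinearMap₂'_apply', eq_comm,
        SimpleGraph.lapMatrix_toLinearMap₂'_apply'_eq_zero_iff_forall_reachable] at h
      have hxw : x w ≠ 0 := h v w hvw ▸ hv
      exact add_pos_of_pos_of_nonneg
        (Finset.sum_pos' (fun i _ ↦ hterm i) ⟨w, Finset.mem_univ w, by positivity⟩)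
        (hL.dotProduct_mulVec_nonneg x)
    · exact add_pos_of_nonneg_of_pos (Finset.sum_nonneg fun i _ ↦ hterm i) h
  exact ⟨hpos, hpos.det_pos⟩
end

section
/- Let R be a commutative ring, n a natural number, a', b' ∈ R, x, y ∈ R^n, and A an n×n matrix over R. Define the (n+3)×(n+3) matrix M with rows: first row (−1, 1, −1, 0ᵀ), second row (1, a', 0, xᵀ), third row (−1, 0, b', yᵀ), and remaining rows (0, x, y, A). Define the (n+2)×(n+2) matrix N with rows: first row (a'+1, −1, xᵀ), second row (−1, b'+1, yᵀ), and remaining rows (x, y, A). Then det M = − det N. -/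
open Matrix

/-- Base case (crossing-loop weight `c = 1`) of the sign computation for
linking matrices of partially augmented chainmail links: performing a `−1`
twist along the crossing loop negates the determinant. -/
theorem det_augmented_base_case
    (R : Type*) [CommRing R] (n : ℕ) (a' b' : R) (x y : Fin n → R)
    (A : Matrix (Fin n) (Fin n) R) :
    let M : Matrix (Fin 3 ⊕ Fin n) (Fin 3 ⊕ Fin n) R :=
      Matrix.fromBlocks !![-1, 1, -1; 1, a', 0; -1, 0, b']
        (Matrix.of ![((0 : Fin n → R)), x, y])
        (Matrix.of ![((0 : Fin n → R)), x, y])ᵀ A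
    let N : Matrix (Fin 2 ⊕ Fin n) (Fin 2 ⊕ Fin n) R :=
      Matrix.fromBlocks !![a' + 1, -1; -1, b' + 1]
        (Matrix.of ![x, y]) (Matrix.of ![x, y])ᵀ A
    M.det = -N.det := by
  intro M N
  let e : Fin 1 ⊕ (Fin 2 ⊕ Fin n) ≃ Fin 3 ⊕ Fin n :=
    (Equiv.sumAssoc _ _ _).symm.trans (finSumFinEquiv.sumCongr (Equiv.refl _))
  let B : Matrix (Fin 1) (Fin 2 ⊕ Fin n) R := Matrix.of fun _ => Sum.elim ![1, -1] 0
  let D : Matrix (Fin 2 ⊕ Fin n) (Fin 2 ⊕ Fin n) R :=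
    Matrix.fromBlocks !![a', 0; 0, b'] (Matrix.of ![x, y]) (Matrix.of ![x, y])ᵀ A
  have hM : M.submatrix e e = Matrix.fromBlocks (-1) B Bᵀ D := by
    ext i j
    rcases i with i | i | i <;> rcases j with j | j | j <;>
      (try fin_cases i) <;> (try fin_cases j)
    all_goals rfl
  have hN : D + Bᵀ * B = N := by
    ext i j
    rcases i with i | i <;> rcases j with j | j <;>
      (try fin_cases i) <;> (try fin_cases j)
    all_goals simp [N, B, D, Matrix.mul_apply]
  let _ : Invertible (-1 : Matrix (Fin 1) (Fin 1) R) := ⟨-1, by simp, by simp⟩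
  have h_inv : ⅟(-1 : Matrix (Fin 1) (Fin 1) R) = -1 := rfl
  rw [← Matrix.det_submatrix_equiv_self e M, hM, Matrix.det_fromBlocks₁₁, ← hN, h_inv]
  simp
end
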